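/- arXiv:2605.08483 — 3 statements merged into one kernel-verified Lean document; each statement's English description precedes it below -/
import Mathlib

section
/- Let k ≥ 1 and let f : ℝ^k → ℝ be Lipschitz continuous and ℤ^k-periodic (f(x + v) = f(x) for all v ∈ ℤ^k). Suppose there are finitely many closed ℤ^k-periodic sets E_1, …, E_s ⊆ ℝ^k, each of which is locally the graph of a C^∞ function of k−1 of the coordinates (every point of E_i has an open neighborhood in which E_i coincides with the graph, over some coordinate hyperplane, of a C^∞ map from an open subset of ℝ^{k−1} to ℝ), and set E = E_1 ∪ … ∪ E_s. Assume: (i) f is real analytic on ℝ^k \ E; (ii) chamber regularity: every point p ∈ E has an open neighborhood U such that U \ E has finitely many connected components. Then for Lebesgue-almost every t > 0, the level set f⁻¹({t}) ∩ [0,1]^k has finite upper (k−1)-dimensional Minkowski content. -/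
open MeasureTheory
open scoped ENNReal

/-- The upper `(k−1)`-dimensional Minkowski content of a set `S ⊆ ℝ^k`:
`limsup_{ε→0⁺} vol({x : dist(x,S) < ε}) / (2ε)`. -/
noncomputable def upperMinkowskiContent {k : ℕ} (S : Set (EuclideanSpace ℝ (Fin k))) : ℝ≥0∞ :=
  Filter.limsup (fun ε : ℝ => volume (Metric.thickening ε S) / ENNReal.ofReal (2 * ε))
    (nhdsWithin 0 (Set.Ioi 0))

/-- Integer translation of a point of `ℝ^k`. -/
noncomputable def intTranslate {k : ℕ} (x : EuclideanSpace ℝ (Fin k)) (v : Fin k → ℤ) :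
    EuclideanSpace ℝ (Fin k) :=
  x + (EuclideanSpace.equiv (Fin k) ℝ).symm (fun i => (v i : ℝ))

/-- Let `f : ℝ^k → ℝ` be Lipschitz and `ℤ^k`-periodic, real analytic away from a
finite union `E` of closed `ℤ^k`-periodic sets, each locally the graph of a `C^∞`
function of `k−1` coordinates, and suppose chamber regularity holds: each point of
`E` has a neighborhood `U` such that `U \ E` has finitely many connected components.
Then for almost every `t > 0`, the level set `f⁻¹({t}) ∩ [0,1]^k` has finite upper
`(k−1)`-dimensional Minkowski content. -/
theorem level_sets_finite_minkowski_content (k : ℕ) (hk : 1 ≤ k)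
    (f : EuclideanSpace ℝ (Fin k) → ℝ) (L : NNReal) (hf : LipschitzWith L f)
    (hper : ∀ (x : EuclideanSpace ℝ (Fin k)) (v : Fin k → ℤ), f (intTranslate x v) = f x)
    (s : ℕ) (Es : Fin s → Set (EuclideanSpace ℝ (Fin k)))
    (hEclosed : ∀ i, IsClosed (Es i))
    (hEper : ∀ i (x : EuclideanSpace ℝ (Fin k)) (v : Fin k → ℤ),
      x ∈ Es i → intTranslate x v ∈ Es i)
    (hgraph : ∀ i, ∀ p ∈ Es i, ∃ (j : Fin k) (U : Set (EuclideanSpace ℝ (Fin k))),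
      IsOpen U ∧ p ∈ U ∧
      ∃ g : ({l : Fin k // l ≠ j} → ℝ) → ℝ, ContDiff ℝ (⊤ : ℕ∞) g ∧
        Es i ∩ U = {x ∈ U | x j = g (fun l => x l.1)})
    (E : Set (EuclideanSpace ℝ (Fin k))) (hE : E = ⋃ i, Es i)
    (hanal : AnalyticOnNhd ℝ f Eᶜ)
    (hchamber : ∀ p ∈ E, ∃ U : Set (EuclideanSpace ℝ (Fin k)), IsOpen U ∧ p ∈ U ∧
      Set.Finite ((fun x => connectedComponentIn (U \ E) x) '' (U \ E))) :
    ∀ᵐ t ∂(volume.restrict (Set.Ioi (0:ℝ))),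
      upperMinkowskiContent
        (f ⁻¹' {t} ∩ {x : EuclideanSpace ℝ (Fin k) | ∀ i, x i ∈ Set.Icc (0:ℝ) 1}) < ⊤ := by
  have hcube : Bornology.IsBounded
      {x : EuclideanSpace ℝ (Fin k) | ∀ i, x i ∈ Set.Icc (0:ℝ) 1} := by
    refine (Metric.isBounded_closedBall (x := (0 : EuclideanSpace ℝ (Fin k)))
      (r := √(∑ _i : Fin k, (1:ℝ)))).subset ?_
    intro x hx
    rw [mem_closedBall_zero_iff, EuclideanSpace.norm_eq]
    apply Real.sqrt_le_sqrt
    apply Finset.sum_le_sum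
    intro i _
    obtain ⟨h0, h1⟩ := hx i
    rw [Real.norm_eq_abs, sq_abs]
    nlinarith
  obtain ⟨R, hR⟩ := hcube.subset_closedBall 0
  set B := Metric.closedBall (0 : EuclideanSpace ℝ (Fin k)) (R + 1) with hB
  have hBfin : volume B < ⊤ := measure_closedBall_lt_top
  have : IsFiniteMeasure (volume.restrict B) := ⟨by simpa using hBfin⟩
  have hfm : Measurable f := hf.continuous.measurable
  set ρ : Measure ℝ := Measure.map f (volume.restrict B) with hρ
  apply ae_restrict_of_ae
  filter_upwards [Besicovitch.ae_tendsto_rnDeriv ρ volume, Measure.rnDeriv_lt_top ρ volume]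
    with t ht hfin
  set M : ℝ := L + 1 with hM
  have hMpos : 0 < M := by positivity
  have hscale : Filter.Tendsto (fun ε : ℝ => M * ε) (nhdsWithin 0 (Set.Ioi 0))
      (nhdsWithin 0 (Set.Ioi 0)) := by
    refine tendsto_nhdsWithin_iff.2 ⟨?_, ?_⟩
    · have : Filter.Tendsto (fun ε : ℝ => M * ε) (nhds 0) (nhds (M * 0)) :=
        (continuous_const.mul continuous_id).tendsto 0
      rw [mul_zero] at this
      exact this.mono_left nhdsWithin_le_nhds
    · filter_upwards [self_mem_nhdsWithin] with ε hε
      exact mul_pos hMpos hε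
  have ht2 := ENNReal.Tendsto.const_mul (a := ENNReal.ofReal M) (ht.comp hscale)
    (Or.inr ENNReal.ofReal_ne_top)
  unfold upperMinkowskiContent
  refine lt_of_le_of_lt (b := ENNReal.ofReal M * ρ.rnDeriv volume t) ?_
    (ENNReal.mul_lt_top ENNReal.ofReal_lt_top hfin)
  rw [← ht2.limsup_eq]
  refine Filter.limsup_le_limsup ?_
  have h1 : ∀ᶠ ε : ℝ in nhdsWithin 0 (Set.Ioi 0), ε < 1 :=
    nhdsWithin_le_nhds (Iio_mem_nhds one_pos)
  filter_upwards [self_mem_nhdsWithin, h1] with ε hε hε1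
  have hε : 0 < ε := hε
  have hsub : volume (Metric.thickening ε
      (f ⁻¹' {t} ∩ {x : EuclideanSpace ℝ (Fin k) | ∀ i, x i ∈ Set.Icc (0:ℝ) 1}))
      ≤ ρ (Metric.closedBall t (M * ε)) := by
    rw [hρ, Measure.map_apply hfm Metric.isClosed_closedBall.measurableSet,
      Measure.restrict_apply (hfm Metric.isClosed_closedBall.measurableSet)]
    apply measure_mono
    intro x hx
    obtain ⟨y, ⟨hy1, hy2⟩, hxy⟩ := Metric.mem_thickening_iff.1 hx
    have hy1 : f y = t := hy1
    refine ⟨?_, ?_⟩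
    · change dist (f x) t ≤ M * ε
      rw [← hy1]
      refine (hf.dist_le_mul x y).trans ?_
      have := L.coe_nonneg
      exact mul_le_mul (by linarith) hxy.le dist_nonneg hMpos.le
    · have h2 := Metric.mem_closedBall.1 (hR hy2)
      rw [hB, Metric.mem_closedBall]
      linarith [dist_triangle x y 0]
  simp only [Function.comp, Real.volume_closedBall]
  refine (ENNReal.div_le_div_right hsub _).trans (le_of_eq ?_)
  have e : 2 * (M * ε) = M * (2 * ε) := by ring
  rw [e, ENNReal.ofReal_mul hMpos.le, div_eq_mul_inv, div_eq_mul_inv,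
    ENNReal.mul_inv (Or.inr ENNReal.ofReal_ne_top) (Or.inl ENNReal.ofReal_ne_top)]
  have hM1 : ENNReal.ofReal M * (ENNReal.ofReal M)⁻¹ = 1 :=
    ENNReal.mul_inv_cancel (by simpa using hMpos) ENNReal.ofReal_ne_top
  calc _ = (ENNReal.ofReal M * (ENNReal.ofReal M)⁻¹) *
        (ρ (Metric.closedBall t (M * ε)) * (ENNReal.ofReal (2 * ε))⁻¹) := by rw [hM1, one_mul]
    _ = _ := by ring
end

section
/- Let Ω ⊆ ℝ² be closed with nonempty boundary ∂Ω, let z be an interior point of Ω and set r = dist(z, ∂Ω). Suppose there exist two distinct points a, b ∈ ∂Ω with ‖z − a‖ = ‖z − b‖ = r. Then the closed ball B̄(z, r) is contained in Ω, and B̄(z, r) is a maximal inscribed disk: for every z' ∈ ℝ² and r' ≥ 0 with B̄(z, r) ⊆ B̄(z', r') ⊆ Ω, one has z' = z and r' = r. -/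
theorem aux_eq {E : Type*} [NormedAddCommGroup E] [InnerProductSpace ℝ E] (u v : E) (r : ℝ)
    (hv : ‖v‖ = r) (h : ‖u‖ + r ≤ ‖u + v‖) : ‖u‖ • v = r • u := by
  subst hv
  have h1 : ‖u + v‖ = ‖u‖ + ‖v‖ := le_antisymm (norm_add_le u v) h
  exact (sameRay_iff_norm_smul_eq.1 (sameRay_iff_norm_add.2 h1))

/-- If `z` is an interior point of a closed set `Ω ⊆ ℝ²` with two distinct nearest
points on `∂Ω`, both at distance `r = dist(z, ∂Ω)`, then the closed ball `B̄(z,r)`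
is contained in `Ω` and is a maximal inscribed disk. -/
theorem two_nearest_points_maximal_disk (Ω : Set (EuclideanSpace ℝ (Fin 2)))
    (hΩ : IsClosed Ω) (hfr : (frontier Ω).Nonempty)
    (z : EuclideanSpace ℝ (Fin 2)) (hz : z ∈ interior Ω)
    (r : ℝ) (hr : r = Metric.infDist z (frontier Ω))
    (a b : EuclideanSpace ℝ (Fin 2)) (ha : a ∈ frontier Ω) (hb : b ∈ frontier Ω)
    (hab : a ≠ b) (hza : ‖z - a‖ = r) (hzb : ‖z - b‖ = r) :
    Metric.closedBall z r ⊆ Ω ∧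
      ∀ (z' : EuclideanSpace ℝ (Fin 2)) (r' : ℝ), 0 ≤ r' →
        Metric.closedBall z r ⊆ Metric.closedBall z' r' →
        Metric.closedBall z' r' ⊆ Ω →
        z' = z ∧ r' = r := by
  have hr0 : 0 < r := by
    rw [← hza, norm_pos_iff, sub_ne_zero]
    rintro rfl
    exact ha.2 hz
  constructor
  · have hsub : Metric.ball z r ⊆ Ω := by
      by_contra hcon
      obtain ⟨x, hx, hxΩ⟩ := Set.not_subset.1 hcon
      have hpre : IsPreconnected (Metric.ball z r) := (convex_ball z r).isPreconnected
      have hcov : Metric.ball z r ⊆ interior Ω ∪ Ωᶜ := by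
        intro y hy
        by_contra hn
        rw [Set.mem_union, not_or, Set.mem_compl_iff, not_not] at hn
        have hyf : y ∈ frontier Ω := ⟨subset_closure hn.2, hn.1⟩
        have := Metric.infDist_le_dist_of_mem (x := z) hyf
        rw [Metric.mem_ball, dist_comm] at hy
        linarith
      obtain ⟨y, -, hy1, hy2⟩ := hpre _ _ isOpen_interior hΩ.isOpen_compl hcov
        ⟨z, Metric.mem_ball_self hr0, hz⟩ ⟨x, hx, hxΩ⟩
      exact hy2 (interior_subset hy1)
    rw [← closure_ball z hr0.ne']
    exact closure_minimal hsub hΩ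
  · intro z' r' hr' h1 h2
    have key : ∀ c ∈ frontier Ω, ‖z - c‖ = r → ‖c - z'‖ = r' := by
      intro c hc hzc
      apply le_antisymm
      · have : c ∈ Metric.closedBall z r := by
          rw [Metric.mem_closedBall, dist_comm, dist_eq_norm]; exact hzc.le
        simpa [dist_eq_norm] using h1 this
      · by_contra hlt
        push Not at hlt
        have hb : c ∈ Metric.ball z' r' := by simpa [dist_eq_norm] using hlt
        exact hc.2 (interior_maximal (Metric.ball_subset_closedBall.trans h2)
          Metric.isOpen_ball hb)
    have hza' := key a ha hza
    have hzb' := key b hb hzb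
    by_cases hzz : z' = z
    · refine ⟨hzz, ?_⟩
      rw [← hza', ← hza, hzz, norm_sub_rev]
    · exfalso
      have hd : 0 < ‖z - z'‖ := norm_pos_iff.2 (sub_ne_zero.2 (Ne.symm hzz))
      have hle : ‖z - z'‖ + r ≤ r' := by
        have hp : z + (r / ‖z - z'‖) • (z - z') ∈ Metric.closedBall z r := by
          rw [Metric.mem_closedBall, dist_eq_norm, add_sub_cancel_left, norm_smul,
            Real.norm_of_nonneg (by positivity), div_mul_cancel₀ _ hd.ne']
        have hq := h1 hp
        rw [Metric.mem_closedBall, dist_eq_norm] at hq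
        have e : z + (r / ‖z - z'‖) • (z - z') - z' = (1 + r / ‖z - z'‖) • (z - z') := by
          module
        rw [e, norm_smul, Real.norm_of_nonneg (by positivity), add_mul,
          div_mul_cancel₀ _ hd.ne', one_mul] at hq
        exact hq
      have f : ∀ c, ‖z - c‖ = r → ‖c - z'‖ = r' → ‖z - z'‖ • (c - z) = r • (z - z') := by
        intro c h3 h4
        apply aux_eq _ _ _ (by rw [norm_sub_rev]; exact h3)
        have : z - z' + (c - z) = c - z' := by abel
        rw [this, h4]; exact hle
      have := (f a hza hza').trans (f b hzb hzb').symm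
      exact hab (sub_left_injective (smul_right_injective _ hd.ne' this))
end

section
/- Let 0 < c < π and A = {(cos t, sin t) : t ∈ [−c, c]} ⊆ ℝ². If z = ρ·(cos α, sin α) with ρ ≥ 0 and c < α < π, then dist(z, A) = ‖z − (cos c, sin c)‖, i.e., the endpoint (cos c, sin c) of the arc is a nearest point of A to z. -/
/-- The point of `ℝ²` (as `EuclideanSpace`) with coordinates `(a, b)`. -/
noncomputable def pt (a b : ℝ) : EuclideanSpace ℝ (Fin 2) :=
  (EuclideanSpace.equiv (Fin 2) ℝ).symm ![a, b]

/-- For the circular arc `A = {(cos t, sin t) : |t| ≤ c}` with `0 < c < π`, a point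
`z = ρ·(cos α, sin α)` with `ρ ≥ 0` and `c < α < π` has the endpoint `(cos c, sin c)`
as a nearest point of `A`: `dist(z, A) = ‖z − (cos c, sin c)‖`. -/
theorem dist_to_arc_endpoint (c : ℝ) (hc0 : 0 < c) (hcπ : c < Real.pi)
    (ρ α : ℝ) (hρ : 0 ≤ ρ) (hα1 : c < α) (hα2 : α < Real.pi) :
    Metric.infDist (ρ • pt (Real.cos α) (Real.sin α))
      {p : EuclideanSpace ℝ (Fin 2) |
        ∃ t ∈ Set.Icc (-c) c, p = pt (Real.cos t) (Real.sin t)} =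
      ‖ρ • pt (Real.cos α) (Real.sin α) - pt (Real.cos c) (Real.sin c)‖ := by
  have hn : ∀ t : ℝ, ‖ρ • pt (Real.cos α) (Real.sin α) - pt (Real.cos t) (Real.sin t)‖ =
      Real.sqrt ((ρ * Real.cos α - Real.cos t) ^ 2 + (ρ * Real.sin α - Real.sin t) ^ 2) := by
    intro t
    rw [EuclideanSpace.norm_eq]
    simp [pt, Fin.sum_univ_two]
  have hmem : pt (Real.cos c) (Real.sin c) ∈ {p : EuclideanSpace ℝ (Fin 2) |
        ∃ t ∈ Set.Icc (-c) c, p = pt (Real.cos t) (Real.sin t)} :=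
    ⟨c, ⟨by linarith, le_refl c⟩, rfl⟩
  apply le_antisymm
  · rw [← dist_eq_norm]
    exact Metric.infDist_le_dist_of_mem hmem
  · rw [Metric.le_infDist ⟨_, hmem⟩]
    rintro p ⟨t, ⟨ht1, ht2⟩, rfl⟩
    rw [dist_eq_norm, hn, hn]
    apply Real.sqrt_le_sqrt
    have h1 : Real.cos (α - t) ≤ Real.cos (α - c) := by
      have e := Real.cos_sub_cos (α - t) (α - c)
      have a1 : 0 ≤ Real.sin ((α - t + (α - c)) / 2) :=
        Real.sin_nonneg_of_nonneg_of_le_pi (by linarith) (by linarith)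
      have a2 : 0 ≤ Real.sin ((α - t - (α - c)) / 2) :=
        Real.sin_nonneg_of_nonneg_of_le_pi (by linarith) (by linarith)
      nlinarith [mul_nonneg a1 a2]
    have h2 := mul_le_mul_of_nonneg_left h1 hρ
    rw [Real.cos_sub, Real.cos_sub] at h2
    nlinarith [Real.sin_sq_add_cos_sq t, Real.sin_sq_add_cos_sq c]
end
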